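/- arXiv:1608.08438 — 5 statements merged into one kernel-verified Lean document; each statement's English description precedes it below -/
import Mathlib

section
/- Let R be an integrally closed domain, k a subfield of R, k₁ an algebraic field extension of k, and S = k₁ ⊗_k R. Then for every prime ideal Q of S there exists exactly one prime ideal P of S such that P ⊆ Q and the contraction of P to R along the canonical map R → S, r ↦ 1 ⊗ r, is the zero ideal. -/
open TensorProduct

open Polynomial in
/-- Core step: comparison of two primes under `Q` contracting to zero. -/
lemma core_le {k R k₁ S : Type*} [Field k] [CommRing R] [IsDomain R] [IsIntegrallyClosed R]
    [Field k₁] [CommRing S] [Algebra k R] [Algebra k k₁] [Algebra k S] [Algebra R S]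
    [Algebra k₁ S] [IsScalarTower k R S] [IsScalarTower k k₁ S]
    (H : ∀ x : S, ∃ n : ℕ, n ≠ 0 ∧ ∃ α : k₁, IsSeparable k α ∧ ∃ h : R[X],
      x ^ n = aeval (algebraMap k₁ S α) h)
    (P₁ P₂ Q : Ideal S) (hP₁ : P₁.IsPrime) (hP₂ : P₂.IsPrime) (hQ : Q.IsPrime)
    (h₁ : P₁ ≤ Q) (h₂ : P₂ ≤ Q) (hc : P₁.comap (algebraMap R S) = ⊥) : P₁ ≤ P₂ := by
  intro x hx
  obtain ⟨n, hn, α, hα, h, hxh⟩ := H x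
  refine hP₂.mem_of_pow_mem n ?_
  have hxn : x ^ n ∈ P₁ := Ideal.pow_mem_of_mem _ hx _ (Nat.pos_of_ne_zero hn)
  rw [hxh] at hxn ⊢
  set a : S := algebraMap k₁ S α with ha
  set f : k[X] := minpoly k α with hf
  have hint : IsIntegral k α := hα.isIntegral
  set F : R[X] := f.map (algebraMap k R) with hF
  have hFa : aeval a F = 0 := by
    rw [hF, aeval_map_algebraMap, ha, aeval_algebraMap_apply, hf, minpoly.aeval, map_zero]
  have hder : aeval a (derivative F) ∉ Q := by
    rw [hF, derivative_map, aeval_map_algebraMap, ha, aeval_algebraMap_apply]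
    intro hm
    have hne : aeval α (derivative f) ≠ 0 :=
      Separable.aeval_derivative_ne_zero hα (minpoly.aeval k α)
    exact hQ.ne_top (Ideal.eq_top_of_isUnit_mem _ hm ((IsUnit.mk0 _ hne).map (algebraMap k₁ S)))
  have hinj : Function.Injective (algebraMap R (S ⧸ P₁)) := by
    rw [injective_iff_map_eq_zero]
    intro r hr
    have : r ∈ P₁.comap (algebraMap R S) := by
      rw [Ideal.mem_comap, ← Ideal.Quotient.eq_zero_iff_mem]
      exact hr
    rwa [hc] at this
  have : FaithfulSMul R (S ⧸ P₁) := (faithfulSMul_iff_algebraMap_injective _ _).2 hinj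
  have : Module.IsTorsionFree R (S ⧸ P₁) := by infer_instance
  set b : S ⧸ P₁ := algebraMap S (S ⧸ P₁) a with hb
  have key : ∀ p : R[X], aeval a p ∈ P₁ ↔ aeval b p = 0 := by
    intro p
    rw [hb, aeval_algebraMap_apply (S ⧸ P₁) a p, ← Ideal.Quotient.eq_zero_iff_mem]
    rfl
  have hFb : aeval b F = 0 := (key F).1 (by rw [hFa]; exact P₁.zero_mem)
  have hbint : IsIntegral R b :=
    ⟨F, (minpoly.monic hint).map _, hFb⟩
  set g := minpoly R b with hg
  have hgP : aeval a g ∈ P₁ := (key g).2 (minpoly.aeval R b)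
  obtain ⟨u, hu⟩ := minpoly.isIntegrallyClosed_dvd hbint hFb
  obtain ⟨v, hv⟩ := minpoly.isIntegrallyClosed_dvd hbint ((key h).1 hxn)
  have hmem : aeval a g * aeval a u ∈ P₂ := by
    rw [← map_mul, ← hu, hFa]; exact P₂.zero_mem
  rcases hP₂.mem_or_mem hmem with h' | h'
  · rw [hv, map_mul]
    exact P₂.mul_mem_right _ h'
  · exfalso
    apply hder
    rw [hu, derivative_mul, map_add, map_mul, map_mul]
    exact Q.add_mem (Q.mul_mem_left _ (h₂ h')) (Q.mul_mem_right _ (h₁ hgP))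

open Polynomial IntermediateField in
/-- Two separable elements are polynomials in a third one. -/
lemma exists_common {k k₁ : Type*} [Field k] [Field k₁] [Algebra k k₁]
    (a b : k₁) (ha : IsSeparable k a) (hb : IsSeparable k b) :
    ∃ c : k₁, IsSeparable k c ∧ (∃ u : k[X], a = aeval c u) ∧ ∃ v : k[X], b = aeval c v := by
  let E : IntermediateField k k₁ := adjoin k {a, b}
  have hsep : Algebra.IsSeparable k E := by
    rw [isSeparable_adjoin_iff_isSeparable]
    rintro x (rfl | rfl)
    exacts [ha, hb]
  have hfin : FiniteDimensional k E := by
    apply finiteDimensional_adjoin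
    rintro x (rfl | rfl)
    exacts [ha.isIntegral, hb.isIntegral]
  obtain ⟨c, hc⟩ := Field.exists_primitive_element k E
  have hpoly : ∀ x : E, ∃ u : k[X], (x : k₁) = aeval (c : k₁) u := by
    intro x
    have hx : x ∈ k⟮c⟯ := by rw [hc]; trivial
    rw [← mem_toSubalgebra,
      adjoin_simple_toSubalgebra_of_isAlgebraic (Algebra.IsAlgebraic.isAlgebraic c),
      Algebra.adjoin_singleton_eq_range_aeval] at hx
    obtain ⟨u, rfl⟩ := hx
    exact ⟨u, (aeval_algebraMap_apply k₁ c u).symm⟩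
  refine ⟨c, ?_, hpoly ⟨a, subset_adjoin _ _ (by simp)⟩, hpoly ⟨b, subset_adjoin _ _ (by simp)⟩⟩
  have := Algebra.IsSeparable.isSeparable k c
  rw [IsSeparable] at this ⊢
  rwa [← minpoly.algebraMap_eq (algebraMap E k₁).injective c] at this

attribute [local instance] Algebra.TensorProduct.rightAlgebra in
open Polynomial in
lemma pow_eq_poly (k : Type*) [Field k] (R : Type*) [CommRing R] [Nontrivial R]
    [Algebra k R] (k₁ : Type*) [Field k₁] [Algebra k k₁] [Algebra.IsAlgebraic k k₁]
    (p : ℕ) [ExpChar k p] [ExpChar (k₁ ⊗[k] R) p] (x : k₁ ⊗[k] R) :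
    ∃ n : ℕ, ∃ α : k₁, IsSeparable k α ∧ ∃ h : R[X],
      x ^ (p ^ n) = aeval (algebraMap k₁ (k₁ ⊗[k] R) α) h := by
  induction x with
  | zero =>
    refine ⟨0, 0, ?_, 0, by simp⟩
    simpa using isSeparable_algebraMap (K := k₁) (0 : k)
  | tmul a r =>
    have : ExpChar (separableClosure k k₁) p :=
      expChar_of_injective_algebraMap (algebraMap k (separableClosure k k₁)).injective p
    obtain ⟨n, y, hy⟩ := IsPurelyInseparable.pow_mem (separableClosure k k₁) p a
    refine ⟨n, a ^ p ^ n, ?_, C (r ^ p ^ n) * X, ?_⟩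
    · rw [← hy]
      exact mem_separableClosure_iff.1 y.2
    · rw [map_mul, aeval_C, aeval_X, Algebra.TensorProduct.tmul_pow,
        Algebra.TensorProduct.right_algebraMap_apply, Algebra.TensorProduct.algebraMap_apply]
      simp
  | add x y hx hy =>
    obtain ⟨n, a, ha, g, hg⟩ := hx
    obtain ⟨m, b, hb, h, hh⟩ := hy
    obtain ⟨c, hc, ⟨u, rfl⟩, ⟨v, rfl⟩⟩ := exists_common a b ha hb
    refine ⟨n + m, c, hc, (g.comp (u.map (algebraMap k R))) ^ p ^ m +
      (h.comp (v.map (algebraMap k R))) ^ p ^ n, ?_⟩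
    rw [add_pow_expChar_pow, map_add, map_pow, map_pow, aeval_comp, aeval_comp,
      aeval_map_algebraMap, aeval_map_algebraMap, aeval_algebraMap_apply _ c u,
      aeval_algebraMap_apply _ c v, ← hg, ← hh, ← pow_mul, ← pow_mul, pow_add, mul_comm (p ^ m)]

attribute [local instance] Algebra.TensorProduct.rightAlgebra in
/-- Let `R` be an integrally closed domain, `k` a subfield of `R`,
`k₁` an algebraic field extension of `k`, and `S = k₁ ⊗[k] R`.  Then for every prime
ideal `Q` of `S` there is exactly one prime ideal `P` of `S` with `P ⊆ Q` whose
contraction to `R` along `r ↦ 1 ⊗ r` is the zero ideal. -/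
theorem unique_prime_below_with_zero_contraction
    (k : Type*) [Field k] (R : Type*) [CommRing R] [IsDomain R] [IsIntegrallyClosed R]
    [Algebra k R] (k₁ : Type*) [Field k₁] [Algebra k k₁] [Algebra.IsAlgebraic k k₁]
    (Q : Ideal (k₁ ⊗[k] R)) (hQ : Q.IsPrime) :
    ∃! P : Ideal (k₁ ⊗[k] R), P.IsPrime ∧ P ≤ Q ∧
      P.comap (Algebra.TensorProduct.includeRight : R →ₐ[k] k₁ ⊗[k] R).toRingHom = ⊥ := by
  have hnt : Nontrivial (k₁ ⊗[k] R) := ⟨⟨0, 1, fun h => hQ.ne_top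
    ((Ideal.eq_top_iff_one _).2 (h ▸ Q.zero_mem))⟩⟩
  obtain ⟨p, hp⟩ := ExpChar.exists k
  have : ExpChar (k₁ ⊗[k] R) p :=
    expChar_of_injective_algebraMap (algebraMap k (k₁ ⊗[k] R)).injective p
  have H := fun x : k₁ ⊗[k] R => pow_eq_poly k R k₁ p x
  have H' : ∀ x : k₁ ⊗[k] R, ∃ n : ℕ, n ≠ 0 ∧ ∃ α : k₁, IsSeparable k α ∧
      ∃ h : Polynomial R, x ^ n = Polynomial.aeval (algebraMap k₁ (k₁ ⊗[k] R) α) h := by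
    intro x
    obtain ⟨n, α, h1, h2⟩ := H x
    exact ⟨p ^ n, pow_ne_zero _ (expChar_pos k p).ne', α, h1, h2⟩
  have hflat : Module.Flat R (k₁ ⊗[k] R) := by
    refine Module.Flat.of_linearEquiv (M := R ⊗[k] k₁) (N := k₁ ⊗[k] R)
      { toFun := TensorProduct.comm k k₁ R
        invFun := (TensorProduct.comm k k₁ R).symm
        left_inv := fun x => by simp
        right_inv := fun x => by simp
        map_add' := fun x y => by simp
        map_smul' := fun r x => ?_ }
    induction x with
    | zero => simp
    | add x y hx hy => simp only [smul_add, map_add, hx, hy]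
    | tmul a s => simp [Algebra.smul_def, Algebra.TensorProduct.right_algebraMap_apply]
  obtain ⟨P, hPQ, hP, hPo⟩ := Ideal.exists_ideal_le_liesOver_of_le (p := (⊥ : Ideal R))
    (q := Q.under R) Q bot_le
  have hP0 : P.comap (algebraMap R (k₁ ⊗[k] R)) = ⊥ := hPo.over.symm
  refine ⟨P, ⟨hP, hPQ, hP0⟩, ?_⟩
  rintro P' ⟨hP', hPQ', hP0'⟩
  exact le_antisymm (core_le H' P' P Q hP' hP hQ hPQ' hPQ hP0')
    (core_le H' P P' Q hP hP' hQ hPQ hPQ' hP0)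
end

section
/- Let R be an integrally closed domain, k a subfield of R, k₁ a finite separable field extension of k, and S = k₁ ⊗_k R. Then S is isomorphic as a ring to a finite product D₁ × ⋯ × D_s of integral domains, each of which is integrally closed in its field of fractions. Equivalently, S has finitely many minimal prime ideals, their intersection is the zero ideal, they are pairwise comaximal, and each quotient of S by a minimal prime ideal is an integrally closed domain. -/
open TensorProduct

theorem core_aux {A : Type*} [CommRing A] {ι : Type*} [Finite ι] {K : ι → Type*}
    [∀ i, Field (K i)] (f : A →+* Π i, K i) (hf : Function.Injective f)
    (hint : ∀ y, f.IsIntegralElem y → ∃ a, f a = y)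
    (hloc : ∀ y, ∃ a b, IsUnit (f b) ∧ y * f b = f a) :
    (minimalPrimes A).Finite ∧ sInf (minimalPrimes A) = ⊥ ∧
    (∀ P ∈ minimalPrimes A, ∀ Q ∈ minimalPrimes A, P ≠ Q → P ⊔ Q = ⊤) ∧
    (∀ P ∈ minimalPrimes A, IsDomain (A ⧸ P) ∧ IsIntegrallyClosed (A ⧸ P)) := by
  classical
  have := Fintype.ofFinite ι
  let g : ∀ i, A →+* K i := fun i => (Pi.evalRingHom K i).comp f
  have hg : ∀ i a, g i a = f a i := fun i a => rfl
  have key : ∀ P ∈ minimalPrimes A, ∃ i, P = RingHom.ker (g i) := by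
    intro P hP
    have hPp : P.IsPrime := hP.1.1
    have hle : (Finset.univ.inf fun i => RingHom.ker (g i)) ≤ P := by
      intro a ha
      have : a = 0 := by
        apply hf
        ext i
        have := (Finset.inf_le (f := fun i => RingHom.ker (g i)) (Finset.mem_univ i)) ha
        simpa [RingHom.mem_ker, hg] using this
      simp [this]
    obtain ⟨i, -, hi⟩ := (Ideal.IsPrime.inf_le' hPp).1 hle
    exact ⟨i, le_antisymm (hP.2 ⟨RingHom.ker_isPrime _, bot_le⟩ hi) hi⟩
  have hred : IsReduced A := isReduced_of_injective f hf
  refine ⟨?_, ?_, ?_, ?_⟩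
  · refine (Set.finite_range fun i => RingHom.ker (g i)).subset ?_
    intro P hP
    obtain ⟨i, rfl⟩ := key P hP
    exact ⟨i, rfl⟩
  · have := Ideal.sInf_minimalPrimes (I := (⊥ : Ideal A))
    rw [show minimalPrimes A = (⊥ : Ideal A).minimalPrimes from rfl, this]
    exact nilradical_eq_zero A
  · intro P hP Q hQ hPQ
    obtain ⟨i, rfl⟩ := key P hP
    obtain ⟨j, rfl⟩ := key Q hQ
    have hij : i ≠ j := by rintro rfl; exact hPQ rfl
    obtain ⟨a, ha⟩ := hint (Pi.single i 1) ⟨Polynomial.X ^ 2 - Polynomial.X, by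
        apply Polynomial.monic_X_pow_sub
        exact lt_of_le_of_lt Polynomial.degree_X_le (by norm_num), by
        simp [Polynomial.eval₂_sub, sq, ← Pi.single_mul]⟩
    rw [Ideal.eq_top_iff_one, Submodule.mem_sup]
    refine ⟨1 - a, ?_, a, ?_, by ring⟩
    · simp [RingHom.mem_ker, hg, ha]
    · simp [RingHom.mem_ker, hg, ha, hij.symm]
  · intro P hP
    have hPp : P.IsPrime := hP.1.1
    refine ⟨inferInstance, ?_⟩
    obtain ⟨i, rfl⟩ := key P hP
    let h : A ⧸ RingHom.ker (g i) →+* K i := RingHom.kerLift (g i)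
    let _ : Algebra (A ⧸ RingHom.ker (g i)) (K i) := h.toAlgebra
    have hinj : Function.Injective (algebraMap (A ⧸ RingHom.ker (g i)) (K i)) :=
      RingHom.kerLift_injective (g i)
    have hmk : ∀ a, algebraMap (A ⧸ RingHom.ker (g i)) (K i) (Ideal.Quotient.mk _ a) = f a i :=
      fun a => rfl
    have : FaithfulSMul (A ⧸ RingHom.ker (g i)) (K i) :=
      (faithfulSMul_iff_algebraMap_injective _ _).2 hinj
    have : IsFractionRing (A ⧸ RingHom.ker (g i)) (K i) := by
      apply IsFractionRing.of_field
      intro z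
      obtain ⟨a, b, hb, hab⟩ := hloc (Pi.single i z)
      refine ⟨Ideal.Quotient.mk _ a, Ideal.Quotient.mk _ b, ?_⟩
      have hb' : f b i ≠ 0 := by
        have := hb.map (Pi.evalRingHom K i)
        exact this.ne_zero
      rw [hmk, hmk, eq_div_iff hb']
      simpa using congrFun hab i
    rw [isIntegrallyClosed_iff (K i)]
    rintro x ⟨p, hp, hx⟩
    obtain ⟨q, hq, -, hqm⟩ := Polynomial.lifts_and_natDegree_eq_and_monic
      (f := Ideal.Quotient.mk (RingHom.ker (g i)))
      (Polynomial.map_surjective _ Ideal.Quotient.mk_surjective p) hp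
    obtain ⟨a, ha⟩ := hint (Pi.single i x) ⟨Polynomial.X * q, Polynomial.monic_X.mul hqm, by
      rw [Polynomial.eval₂_mul, Polynomial.eval₂_X]
      ext j
      by_cases hj : j = i
      · subst hj
        rw [← hq, Polynomial.eval₂_map] at hx
        have : (Polynomial.eval₂ f (Pi.single j x) q) j = 0 := by
          have h2 := Polynomial.hom_eval₂ q f (Pi.evalRingHom K j) (Pi.single j x)
          rw [Pi.evalRingHom_apply, Pi.evalRingHom_apply, Pi.single_eq_same] at h2
          rw [h2]
          exact hx
        simp [this]
      · simp [hj]⟩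
    refine ⟨Ideal.Quotient.mk _ a, ?_⟩
    rw [hmk, ha]
    simp


/-- Let `R` be an integrally closed domain, `k` a subfield of `R`,
`k₁` a finite separable field extension of `k`, and `S = k₁ ⊗[k] R`.  Then `S` is a
finite product of integrally closed domains; equivalently, `S` has finitely many
minimal primes, their intersection is `(0)`, they are pairwise comaximal, and each
quotient by a minimal prime is an integrally closed domain. -/
theorem tensor_finite_separable_is_product_of_integrally_closed_domains
    (k : Type*) [Field k] (R : Type*) [CommRing R] [IsDomain R] [IsIntegrallyClosed R]
    [Algebra k R] (k₁ : Type*) [Field k₁] [Algebra k k₁]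
    [FiniteDimensional k k₁] [Algebra.IsSeparable k k₁] :
    (minimalPrimes (k₁ ⊗[k] R)).Finite ∧
    sInf (minimalPrimes (k₁ ⊗[k] R)) = ⊥ ∧
    (∀ P ∈ minimalPrimes (k₁ ⊗[k] R), ∀ Q ∈ minimalPrimes (k₁ ⊗[k] R),
      P ≠ Q → P ⊔ Q = ⊤) ∧
    (∀ P ∈ minimalPrimes (k₁ ⊗[k] R),
      IsDomain ((k₁ ⊗[k] R) ⧸ P) ∧ IsIntegrallyClosed ((k₁ ⊗[k] R) ⧸ P)) := by
  let AA := R ⊗[k] k₁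
  let K := FractionRing R
  have hft : Algebra.FiniteType k k₁ := inferInstance
  have : Algebra.FormallyEtale k k₁ := Algebra.FormallyEtale.of_isSeparable k k₁
  have : Algebra.Etale k k₁ := ⟨inferInstance, Algebra.FinitePresentation.of_finiteType.mp hft⟩
  have hAA : Algebra.Etale R AA := inferInstance
  have hF : Algebra.Etale K (K ⊗[R] AA) := inferInstance
  obtain ⟨I, _, Ai, _, _, e, -⟩ := (Algebra.Etale.iff_exists_algEquiv_prod K (K ⊗[R] AA)).1 hF
  let inc : AA →+* K ⊗[R] AA := (Algebra.TensorProduct.includeRight : AA →ₐ[R] K ⊗[R] AA)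
  have hinc : ∀ a, inc a = 1 ⊗ₜ a := fun a => rfl
  let c : k₁ ⊗[k] R →+* AA := (Algebra.TensorProduct.comm k k₁ R).toRingHom
  have hc : Function.Bijective c := (Algebra.TensorProduct.comm k k₁ R).bijective
  refine core_aux (((e : K ⊗[R] AA →+* Π i, Ai i).comp inc).comp c) ?_ ?_ ?_
  · refine (e.injective.comp ?_).comp hc.1
    exact Algebra.TensorProduct.includeRight_injective (IsFractionRing.injective R K)
  · rintro y ⟨p, hp, hy⟩
    have h1 : inc.IsIntegralElem (e.symm y) := by
      refine ⟨p.map c, hp.map c, ?_⟩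
      apply e.injective
      have h2 := Polynomial.hom_eval₂ (p.map c) inc (e : K ⊗[R] AA →+* Π i, Ai i) (e.symm y)
      refine Eq.trans h2 ?_
      rw [Polynomial.eval₂_map, map_zero]
      simpa using hy
    have h3 : IsIntegral AA (Algebra.TensorProduct.comm R K AA (e.symm y)) := by
      obtain ⟨q, hq, hq0⟩ := h1
      refine ⟨q, hq, ?_⟩
      have h2 := Polynomial.hom_eval₂ q inc
        (Algebra.TensorProduct.comm R K AA : K ⊗[R] AA →+* AA ⊗[R] K) (e.symm y)
      rw [hq0, map_zero] at h2
      exact h2.symm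
    obtain ⟨z, hz⟩ := (TensorProduct.toIntegralClosure_bijective_of_smooth
      (R := R) (S := AA) (B := K)).2 ⟨_, h3⟩
    have h4 : ∀ z, ∃ a : AA, (TensorProduct.toIntegralClosure R AA K z : AA ⊗[R] K) = a ⊗ₜ 1 := by
      intro z
      induction z with
      | zero => exact ⟨0, by simp⟩
      | add x y hx hy =>
        obtain ⟨a, ha⟩ := hx
        obtain ⟨b, hb⟩ := hy
        exact ⟨a + b, by rw [map_add, TensorProduct.add_tmul, ← ha, ← hb]; rfl⟩
      | tmul a b =>
        obtain ⟨r, hr⟩ := IsIntegrallyClosed.isIntegral_iff.1 b.2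
        refine ⟨r • a, ?_⟩
        change a ⊗ₜ[R] (b : K) = _
        rw [TensorProduct.smul_tmul, ← hr, Algebra.algebraMap_eq_smul_one]
    obtain ⟨a, ha⟩ := h4 z
    rw [hz] at ha
    obtain ⟨a₀, rfl⟩ := hc.2 a
    refine ⟨a₀, ?_⟩
    change e (1 ⊗ₜ c a₀) = y
    rw [← AlgEquiv.eq_symm_apply]
    apply (Algebra.TensorProduct.comm R K AA).injective
    exact ha.symm
  · intro y
    have h5 : ∀ z : K ⊗[R] AA, ∃ r : R, r ≠ 0 ∧ ∃ a : AA, r • z = 1 ⊗ₜ a := by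
      intro z
      induction z with
      | zero => exact ⟨1, one_ne_zero, 0, by simp⟩
      | add x y hx hy =>
        obtain ⟨r, hr, a, ha⟩ := hx
        obtain ⟨s, hs, b, hb⟩ := hy
        refine ⟨r * s, mul_ne_zero hr hs, s • a + r • b, ?_⟩
        rw [TensorProduct.tmul_add, TensorProduct.tmul_smul, TensorProduct.tmul_smul, ← ha, ← hb,
          smul_add, smul_smul, smul_smul, mul_comm s r]
      | tmul x a =>
        obtain ⟨b, r, hr⟩ := IsLocalization.exists_integer_multiple (nonZeroDivisors R) x
        refine ⟨b, nonZeroDivisors.ne_zero b.2, r • a, ?_⟩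
        rw [TensorProduct.smul_tmul', ← hr, TensorProduct.tmul_smul, TensorProduct.smul_tmul',
          Algebra.algebraMap_eq_smul_one]
    obtain ⟨r, hr, a, ha⟩ := h5 (e.symm y)
    obtain ⟨a₀, rfl⟩ := hc.2 a
    obtain ⟨b₀, hb₀⟩ := hc.2 (algebraMap R AA r)
    have h6 : inc (c b₀) = algebraMap K (K ⊗[R] AA) (algebraMap R K r) := by
      rw [hb₀, hinc, ← IsScalarTower.algebraMap_apply R K (K ⊗[R] AA)]
      exact (Algebra.TensorProduct.includeRight : AA →ₐ[R] K ⊗[R] AA).commutes r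
    refine ⟨a₀, b₀, ?_, ?_⟩
    · change IsUnit (e (inc (c b₀)))
      rw [h6]
      have hu : IsUnit (algebraMap R K r) :=
        isUnit_iff_ne_zero.2 (by simpa using hr)
      exact (hu.map (algebraMap K (K ⊗[R] AA))).map e
    · change y * e (inc (c b₀)) = e (inc (c a₀))
      rw [hinc (c a₀), ← ha, h6, ← IsScalarTower.algebraMap_apply R K (K ⊗[R] AA)]
      have h7 : r • e.symm y = algebraMap R (K ⊗[R] AA) r * e.symm y := by
        generalize e.symm y = z
        induction z with
        | zero => simp
        | add x y hx hy => rw [smul_add, mul_add, hx, hy]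
        | tmul x a =>
          rw [TensorProduct.smul_tmul', Algebra.TensorProduct.algebraMap_apply,
            Algebra.TensorProduct.tmul_mul_tmul, one_mul, Algebra.smul_def]
      rw [h7, map_mul, AlgEquiv.apply_symm_apply, mul_comm]
end

section
/- Let k be a field, σ₀ a field automorphism of k, and n a natural number. Let A = k[X_{j,i} : 1 ≤ j ≤ n, i ∈ ℤ] be the polynomial ring in variables indexed by Fin n × ℤ, and let Σ be the ring automorphism of A acting as σ₀ on coefficients and sending X_{j,i} to X_{j,i+1}. Let B₀, B₁ and B be the k-subalgebras of A generated respectively by the variables {X_{j,0} : j}, {X_{j,1} : j}, and {X_{j,0}, X_{j,1} : j}. Suppose P is a prime ideal of B such that Σ maps P ∩ B₀ onto P ∩ B₁ (note Σ(B₀) = B₁). Then there exists a prime ideal P̃ of A with Σ(P̃) = P̃ and P̃ ∩ B = P. -/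
open MvPolynomial

universe u

section Aux
open Cardinal

/-- Two algebraically closed extensions of the same large cardinality are isomorphic
over the base. -/
theorem aux_algEquiv {R K L : Type u} [CommRing R] [Field K] [Field L] [Algebra R K]
    [Algebra R L] [IsAlgClosed K] [IsAlgClosed L] [FaithfulSMul R K] [FaithfulSMul R L]
    (hK : ℵ₀ < #K) (hRK : #R < #K) (hKL : #K = #L) :
    ∃ τ : K ≃+* L, ∀ r : R, τ (algebraMap R K r) = algebraMap R L r := by
  obtain ⟨s, hs⟩ := exists_isTranscendenceBasis R K
  obtain ⟨t, ht⟩ := exists_isTranscendenceBasis R L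
  have h1 : #s = #K := by
    apply le_antisymm (mk_set_le s)
    have := IsAlgClosed.cardinal_le_max_transcendence_basis' _ hs
    rcases le_max_iff.1 this with h | h
    · rcases le_max_iff.1 h with h | h
      · exact absurd h (not_le.2 hRK)
      · exact h
    · exact absurd h (not_le.2 hK)
  have h2 : #t = #L := by
    apply le_antisymm (mk_set_le t)
    have := IsAlgClosed.cardinal_le_max_transcendence_basis' _ ht
    rw [hKL] at hRK hK
    rcases le_max_iff.1 this with h | h
    · rcases le_max_iff.1 h with h | h
      · exact absurd h (not_le.2 hRK)
      · exact h
    · exact absurd h (not_le.2 hK)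
  obtain ⟨e⟩ := Cardinal.eq.1 (h1.trans (hKL.trans h2.symm))
  let := IsAlgClosed.isAlgClosure_of_transcendence_basis _ hs
  let := IsAlgClosed.isAlgClosure_of_transcendence_basis _ ht
  let E := hs.1.aevalEquiv.symm.trans ((renameEquiv R e).trans ht.1.aevalEquiv)
  refine ⟨IsAlgClosure.equivOfEquiv K L E.toRingEquiv, fun r => ?_⟩
  have h := IsAlgClosure.equivOfEquiv_algebraMap K L E.toRingEquiv (algebraMap R _ r)
  have h3 : E.toRingEquiv (algebraMap R _ r) = algebraMap R _ r := E.commutes r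
  rw [h3] at h
  exact h

theorem aux_auto {R L : Type u} [CommRing R] [Field L] [IsAlgClosed L] (f g : R →+* L)
    (hfg : ∀ r, f r = 0 ↔ g r = 0) (hL : ℵ₀ < #L) (hR : #R < #L) :
    ∃ τ : L ≃+* L, ∀ r, τ (f r) = g r := by
  let I := RingHom.ker f
  let f' : R ⧸ I →+* L := Ideal.Quotient.lift I f fun a ha => ha
  let g' : R ⧸ I →+* L := Ideal.Quotient.lift I g fun a ha => (hfg a).1 ha
  have hf' : Function.Injective f' := by
    rw [injective_iff_map_eq_zero]
    intro a
    obtain ⟨a, rfl⟩ := Ideal.Quotient.mk_surjective a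
    intro h
    exact Ideal.Quotient.eq_zero_iff_mem.2 h
  have hg' : Function.Injective g' := by
    rw [injective_iff_map_eq_zero]
    intro a
    obtain ⟨a, rfl⟩ := Ideal.Quotient.mk_surjective a
    intro h
    exact Ideal.Quotient.eq_zero_iff_mem.2 ((hfg a).2 h)
  have hq : #(R ⧸ I) < #L := (mk_le_of_surjective Ideal.Quotient.mk_surjective).trans_lt hR
  obtain ⟨τ, hτ⟩ := @aux_algEquiv (R ⧸ I) L L _ _ _ f'.toAlgebra g'.toAlgebra _ _
    (by let := f'.toAlgebra; exact (faithfulSMul_iff_algebraMap_injective _ _).2 hf')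
    (by let := g'.toAlgebra; exact (faithfulSMul_iff_algebraMap_injective _ _).2 hg')
    hL hq rfl
  exact ⟨τ, fun r => hτ (Ideal.Quotient.mk I r)⟩

theorem aux_big (K : Type u) [Field K] (T : Type u) :
    ∃ (L : Type u) (_ : Field L) (_ : IsAlgClosed L) (_ : K →+* L), ℵ₀ < #L ∧ #T < #L := by
  let S := Set (T ⊕ ULift.{u} ℕ)
  let L := AlgebraicClosure (FractionRing (MvPolynomial S K))
  have hS : #(T ⊕ ULift.{u} ℕ) < #L := by
    refine (cantor _).trans_le ?_
    rw [← mk_set]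
    let φ : MvPolynomial S K →+* L := (algebraMap (FractionRing (MvPolynomial S K)) L).comp
      (algebraMap _ _)
    have hφ : Function.Injective φ :=
      (algebraMap (FractionRing (MvPolynomial S K)) L).injective.comp
        (IsFractionRing.injective _ _)
    exact mk_le_of_injective (f := fun s : S => φ (X s)) (hφ.comp (X_injective))
  refine ⟨L, inferInstance, inferInstance,
    ((algebraMap (FractionRing (MvPolynomial S K)) L).comp
      (algebraMap (MvPolynomial S K) _)).comp C, ?_, ?_⟩
  · refine lt_of_le_of_lt ?_ hS
    simp
  · refine lt_of_le_of_lt ?_ hS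
    exact mk_le_of_injective Sum.inl_injective

theorem aux_ev (B : Type u) [CommRing B] (P : Ideal B) (hP : P.IsPrime) (T : Type u) :
    ∃ (L : Type u) (_ : Field L) (_ : IsAlgClosed L) (ev : B →+* L),
      (∀ b, ev b = 0 ↔ b ∈ P) ∧ ℵ₀ < #L ∧ #T < #L := by
  obtain ⟨L, _, _, ι, hL, hT⟩ := aux_big (FractionRing (B ⧸ P)) T
  refine ⟨L, inferInstance, inferInstance,
    (ι.comp (algebraMap (B ⧸ P) _)).comp (Ideal.Quotient.mk P), fun b => ?_, hL, hT⟩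
  rw [← Ideal.Quotient.eq_zero_iff_mem]
  have : Function.Injective (ι.comp (algebraMap (B ⧸ P) (FractionRing (B ⧸ P)))) :=
    ι.injective.comp (IsFractionRing.injective _ _)
  exact map_eq_zero_iff _ this

end Aux

/-- Let `A = k[X_{j,i} : 1 ≤ j ≤ n, i ∈ ℤ]`, and let `Φ` be the ring
automorphism of `A` acting as `σ₀` on coefficients and sending `X_{j,i}` to
`X_{j,i+1}`.  Let `B₀`, `B₁`, `B` be the `k`-subalgebras generated by the variables
`{X_{j,0}}`, `{X_{j,1}}` and `{X_{j,0}, X_{j,1}}` respectively.  If `P` is a prime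
ideal of `B` such that `Φ` maps `P ∩ B₀` onto `P ∩ B₁`, then `P` extends to a
`Φ`-invariant prime ideal of `A`. -/
theorem exists_invariant_prime_extension
    (k : Type*) [Field k] (σ₀ : k ≃+* k) (n : ℕ)
    (Φ : MvPolynomial (Fin n × ℤ) k ≃+* MvPolynomial (Fin n × ℤ) k)
    (hΦC : ∀ c : k, Φ (C c) = C (σ₀ c))
    (hΦX : ∀ (j : Fin n) (i : ℤ), Φ (X (j, i)) = X (j, i + 1))
    (B₀ : Subalgebra k (MvPolynomial (Fin n × ℤ) k))
    (hB₀ : B₀ = Algebra.adjoin k {x | ∃ j : Fin n, x = X (j, 0)})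
    (B₁ : Subalgebra k (MvPolynomial (Fin n × ℤ) k))
    (hB₁ : B₁ = Algebra.adjoin k {x | ∃ j : Fin n, x = X (j, 1)})
    (B : Subalgebra k (MvPolynomial (Fin n × ℤ) k))
    (hB : B = Algebra.adjoin k {x | ∃ j : Fin n, x = X (j, 0) ∨ x = X (j, 1)})
    (P : Ideal B) (hP : P.IsPrime)
    (hmap : Φ '' {x | x ∈ B₀ ∧ ∃ hx : x ∈ B, (⟨x, hx⟩ : B) ∈ P}
          = {x | x ∈ B₁ ∧ ∃ hx : x ∈ B, (⟨x, hx⟩ : B) ∈ P}) :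
    ∃ P' : Ideal (MvPolynomial (Fin n × ℤ) k), P'.IsPrime ∧
      Ideal.map (Φ : MvPolynomial (Fin n × ℤ) k →+* MvPolynomial (Fin n × ℤ) k) P' = P' ∧
      Ideal.comap B.val P' = P := by
  classical
  have hX0 : ∀ j, (X (j, 0) : MvPolynomial (Fin n × ℤ) k) ∈ B := fun j => by
    rw [hB]; exact Algebra.subset_adjoin ⟨j, Or.inl rfl⟩
  have hX1 : ∀ j, (X (j, 1) : MvPolynomial (Fin n × ℤ) k) ∈ B := fun j => by
    rw [hB]; exact Algebra.subset_adjoin ⟨j, Or.inr rfl⟩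
  obtain ⟨L, _, _, ev, hev, hL, hT⟩ := aux_ev B P hP (MvPolynomial (Fin n) k)
  let c : k →+* L := ev.comp (algebraMap k B)
  -- the two maps to `B`
  let e0 : MvPolynomial (Fin n) k →+* B :=
    eval₂Hom (algebraMap k B) fun j => ⟨X (j, 0), hX0 j⟩
  let e1 : MvPolynomial (Fin n) k →+* B :=
    eval₂Hom ((algebraMap k B).comp (σ₀ : k →+* k)) fun j => ⟨X (j, 1), hX1 j⟩
  have he : ∀ r, Φ (e0 r : MvPolynomial (Fin n × ℤ) k) = e1 r := by
    have : ((Φ : MvPolynomial (Fin n × ℤ) k →+* MvPolynomial (Fin n × ℤ) k).comp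
        ((B.val : B →+* _))).comp e0 = (B.val : B →+* _).comp e1 := by
      apply ringHom_ext
      · intro a
        simpa [e0, e1, algebraMap_eq] using hΦC a
      · intro j
        simpa [e0, e1] using hΦX j 0
    exact fun r => RingHom.congr_fun this r
  have hm0 : ∀ r, (e0 r : MvPolynomial (Fin n × ℤ) k) ∈ B₀ := by
    intro r
    induction r using MvPolynomial.induction_on with
    | C a => simpa [e0] using B₀.algebraMap_mem a
    | add p q hp hq => rw [map_add]; exact B₀.add_mem hp hq
    | mul_X p j hp =>
      rw [map_mul]
      refine B₀.mul_mem hp ?_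
      rw [hB₀]
      exact Algebra.subset_adjoin ⟨j, by simp [e0]⟩
  have hm1 : ∀ r, (e1 r : MvPolynomial (Fin n × ℤ) k) ∈ B₁ := by
    intro r
    induction r using MvPolynomial.induction_on with
    | C a => simpa [e1] using B₁.algebraMap_mem (σ₀ a)
    | add p q hp hq => rw [map_add]; exact B₁.add_mem hp hq
    | mul_X p j hp =>
      rw [map_mul]
      refine B₁.mul_mem hp ?_
      rw [hB₁]
      exact Algebra.subset_adjoin ⟨j, by simp [e1]⟩
  obtain ⟨τ, hτ⟩ := aux_auto (ev.comp e0) (ev.comp e1) (fun r => by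
    simp only [RingHom.comp_apply, hev]
    constructor
    · intro h
      have : Φ (e0 r : MvPolynomial (Fin n × ℤ) k) ∈
          {x | x ∈ B₁ ∧ ∃ hx : x ∈ B, (⟨x, hx⟩ : B) ∈ P} := by
        rw [← hmap]
        exact ⟨_, ⟨hm0 r, (e0 r).2, h⟩, rfl⟩
      rw [he] at this
      exact this.2.2
    · intro h
      have : (e1 r : MvPolynomial (Fin n × ℤ) k) ∈
          {x | x ∈ B₁ ∧ ∃ hx : x ∈ B, (⟨x, hx⟩ : B) ∈ P} := ⟨hm1 r, (e1 r).2, h⟩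
      rw [← hmap] at this
      obtain ⟨x, ⟨-, hx, hxP⟩, hxe⟩ := this
      rw [← he] at hxe
      have := Φ.injective hxe
      subst this
      exact hxP) hL hT
  have hτC : ∀ a, τ (c a) = c (σ₀ a) := fun a => by
    simpa [e0, e1, c] using hτ (C a)
  have hτX : ∀ j, τ (ev ⟨X (j, 0), hX0 j⟩) = ev ⟨X (j, 1), hX1 j⟩ := fun j => by
    simpa [e0, e1] using hτ (X j)
  let T : RingAut L := τ
  let F : MvPolynomial (Fin n × ℤ) k →+* L :=
    eval₂Hom c fun p => (T ^ p.2) (ev ⟨X (p.1, 0), hX0 p.1⟩)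
  have hF : ∀ x, F (Φ x) = τ (F x) := by
    have : F.comp (Φ : MvPolynomial (Fin n × ℤ) k →+* MvPolynomial (Fin n × ℤ) k) =
        (τ : L →+* L).comp F := by
      apply ringHom_ext
      · intro a
        simp [F, hΦC, hτC]
      · rintro ⟨j, i⟩
        have : T ^ (i + 1) = T * T ^ i := by rw [add_comm, zpow_add, zpow_one]
        simp [F, hΦX, this, T]
    exact fun x => RingHom.congr_fun this x
  have hFB : ∀ b : B, F b = ev b := by
    rintro ⟨b, hb⟩
    have hb' := hb
    rw [hB] at hb'
    induction hb' using Algebra.adjoin_induction with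
    | mem x hx =>
      obtain ⟨j, rfl | rfl⟩ := hx
      · simp [F]
      · simp [F, T, hτX]
    | algebraMap a => simp [F, c, algebraMap_eq]; rfl
    | add x y hx hy h1 h2 =>
      rw [← hB] at hx hy
      have := congrArg₂ (· + ·) (h1 hx) (h2 hy)
      simp only [← map_add] at this
      exact this
    | mul x y hx hy h1 h2 =>
      rw [← hB] at hx hy
      have := congrArg₂ (· * ·) (h1 hx) (h2 hy)
      simp only [← map_mul] at this
      exact this
  refine ⟨RingHom.ker F, RingHom.ker_isPrime F, ?_, ?_⟩
  · ext x
    constructor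
    · intro h
      obtain ⟨y, hy, rfl⟩ := (Ideal.mem_map_iff_of_surjective _ Φ.surjective).1 h
      rw [RingHom.mem_ker] at hy ⊢
      have := hF y
      rw [hy, map_zero] at this
      exact this
    · intro h
      refine (Ideal.mem_map_iff_of_surjective _ Φ.surjective).2 ⟨Φ.symm x, ?_, Φ.apply_symm_apply x⟩
      rw [RingHom.mem_ker] at h ⊢
      have := hF (Φ.symm x)
      rw [Φ.apply_symm_apply, h] at this
      exact (map_eq_zero_iff τ τ.injective).1 this.symm
  · ext b
    rw [Ideal.mem_comap, RingHom.mem_ker, ← hev, ← hFB]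
    rfl
end

section
/- Let Ω be a field with a ring automorphism σ, let k be a subfield of Ω with σ(k) = k, and let a = (a₁,…,a_r) be a tuple of elements of Ω. For n ≥ 0 set K_n = k(σ^i(a_j) : 0 ≤ i ≤ n, 1 ≤ j ≤ r), and assume each degree [K_{n+1} : K_n] is finite, so the limit degree ld_σ(a/k), the eventual constant value of the non-increasing sequence ([K_{n+1} : K_n])_n, is defined. Then the following are equivalent: (i) [k(a, σ(a)) : k(a)] = ld_σ(a/k); (ii) the subfields k(σ^i(a) : i ≤ 0) and k(σ^i(a) : i ≥ 0) of Ω are linearly disjoint over k(a). -/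
set_option synthInstance.maxHeartbeats 1000000
set_option maxHeartbeats 2000000

/-- The degree `[E(E') : E]` of the subfield of `Ω` generated by `E'` over `E`;
for `E ≤ E'` this is the degree of the field extension `E ⊆ E'`.  (It is `0` when
this degree is infinite.) -/
noncomputable def sdeg {Ω : Type*} [Field Ω] (E E' : Subfield Ω) : ℕ :=
  Module.finrank E (IntermediateField.adjoin E (E' : Set Ω))

/-- The subfield `K(σ^{ℓ i}(c_j) : 0 ≤ i ≤ n, j)` of `Ω`. -/
def seqField {Ω : Type*} [Field Ω] (σ : Ω ≃+* Ω) (K : Subfield Ω) {ι : Type*}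
    (c : ι → Ω) (ℓ n : ℕ) : Subfield Ω :=
  Subfield.closure ((K : Set Ω) ∪ {x | ∃ j : ι, ∃ i : ℕ, i ≤ n ∧ x = (σ ^ (ℓ * i)) (c j)})

/-- The subfield `k(σ^i(c_j) : i ∈ s, j)` of `Ω`, for a set `s` of integers. -/
def zSeqField {Ω : Type*} [Field Ω] (σ : Ω ≃+* Ω) (k : Subfield Ω) {ι : Type*}
    (c : ι → Ω) (s : Set ℤ) : Subfield Ω :=
  Subfield.closure ((k : Set Ω) ∪ {x | ∃ j : ι, ∃ i ∈ s, x = (σ ^ i) (c j)})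

open Module

theorem ld_aux_span {F Ω : Type*} [Field F] [Field Ω] [Algebra F Ω]
    (A B : IntermediateField F Ω) [FiniteDimensional F B] {ι : Type*} (b : Basis ι F B) :
    Submodule.span A (Set.range (B.val ∘ b)) =
      Subalgebra.toSubmodule (IntermediateField.adjoin A (B : Set Ω)).toSubalgebra := by
  have h : (IntermediateField.adjoin A (B : Set Ω)).toSubalgebra =
      Algebra.adjoin A (B : Set Ω) :=
    B.adjoin_intermediateField_toSubalgebra_of_isAlgebraic A (Or.inr inferInstance)
  rw [h]
  apply le_antisymm
  · rw [Submodule.span_le]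
    rintro _ ⟨i, rfl⟩
    exact Algebra.subset_adjoin (b i).2
  · have h2 : (Submonoid.closure (B : Set Ω) : Set Ω) = B :=
      congrArg SetLike.coe (Submonoid.closure_eq B.toSubalgebra.toSubmonoid)
    rw [Algebra.adjoin_eq_span, h2, Submodule.span_le]
    intro x hx
    have h3 : (⟨x, hx⟩ : B) ∈ Submodule.span F (Set.range b) := by rw [b.span_eq]; trivial
    have h4 : x ∈ (Submodule.span F (Set.range b)).map B.val.toLinearMap := ⟨_, h3, rfl⟩
    rw [Submodule.map_span, ← Set.range_comp] at h4
    exact Submodule.span_le_restrictScalars F A _ h4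

theorem ld_aux_finrank {F Ω : Type*} [Field F] [Field Ω] [Algebra F Ω]
    (A B : IntermediateField F Ω) [FiniteDimensional F B] :
    finrank A (IntermediateField.adjoin A (B : Set Ω)) ≤ finrank F B ∧
    (A.LinearDisjoint B ↔ finrank A (IntermediateField.adjoin A (B : Set Ω)) = finrank F B) := by
  have b := finBasis F B
  have hs := ld_aux_span A B b
  have hr : (Set.range (B.val ∘ b)).finrank A =
      finrank A (IntermediateField.adjoin A (B : Set Ω)) := by
    unfold Set.finrank
    rw [hs]; rfl
  rw [← hr]
  refine ⟨by simpa using finrank_range_le_card (R := A) (B.val ∘ b), ?_⟩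
  have hc := linearIndependent_iff_card_eq_finrank_span (R := A) (b := B.val ∘ b)
  rw [Fintype.card_fin] at hc
  constructor
  · intro H
    exact (hc.1 (H.linearIndependent_right b.linearIndependent)).symm
  · intro H
    exact IntermediateField.LinearDisjoint.of_basis_right b (hc.2 H.symm)

theorem adjoin_eq_extendScalars {Ω : Type*} [Field Ω] {E A : Subfield Ω} (h : E ≤ A) :
    IntermediateField.adjoin E (A : Set Ω) = Subfield.extendScalars h := by
  apply le_antisymm
  · rw [IntermediateField.adjoin_le_iff]; exact fun x hx => hx
  · exact fun x hx => IntermediateField.subset_adjoin E _ hx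

theorem sdeg_eq_relfinrank {Ω : Type*} [Field Ω] {E A : Subfield Ω} (h : E ≤ A) :
    sdeg E A = E.relfinrank A := by
  rw [sdeg, adjoin_eq_extendScalars h, Subfield.relfinrank_eq_finrank_of_le h]

theorem ld_key {Ω : Type*} [Field Ω] {E A B C : Subfield Ω} (hA : E ≤ A) (hB : E ≤ B)
    (hC : A ⊔ B = C) (hpos : 0 < E.relfinrank B) :
    A.relfinrank C ≤ E.relfinrank B ∧
    ((IntermediateField.adjoin E (A : Set Ω)).LinearDisjoint (IntermediateField.adjoin E (B : Set Ω))
      ↔ A.relfinrank C = E.relfinrank B) := by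
  subst hC
  rw [adjoin_eq_extendScalars hA, adjoin_eq_extendScalars hB]
  rw [Subfield.relfinrank_eq_finrank_of_le hB] at hpos ⊢
  have : FiniteDimensional E (Subfield.extendScalars hB) := FiniteDimensional.of_finrank_pos hpos
  have key := ld_aux_finrank (Subfield.extendScalars hA) (Subfield.extendScalars hB)
  have h : finrank (Subfield.extendScalars hA) (IntermediateField.adjoin (Subfield.extendScalars hA)
      ((Subfield.extendScalars hB : IntermediateField E Ω) : Set Ω)) = A.relfinrank (A ⊔ B) := by
    rw [Subfield.relfinrank_eq_finrank_of_le le_sup_left]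
    have h1 : IntermediateField.adjoin A (B : Set Ω) =
        Subfield.extendScalars (le_sup_left : A ≤ A ⊔ B) := by
      apply le_antisymm
      · rw [IntermediateField.adjoin_le_iff]; exact fun x hx => (le_sup_right : B ≤ A ⊔ B) hx
      · rw [Subfield.extendScalars_le_iff, sup_le_iff]
        exact ⟨fun x hx => (IntermediateField.adjoin A (B : Set Ω)).algebraMap_mem ⟨x, hx⟩,
          fun x hx => IntermediateField.subset_adjoin A _ hx⟩
    rw [← h1]
    rfl
  rw [h] at key
  exact key

section
variable {Ω : Type*} [Field Ω] (σ : Ω ≃+* Ω) (k : Subfield Ω) {ι : Type*} (a : ι → Ω)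

theorem zSeq_mono {s t : Set ℤ} (h : s ⊆ t) : zSeqField σ k a s ≤ zSeqField σ k a t := by
  apply Subfield.closure_mono
  apply Set.union_subset_union_right
  rintro x ⟨j, i, hi, rfl⟩
  exact ⟨j, i, h hi, rfl⟩

theorem zSeq_le {s : Set ℤ} {L : Subfield Ω} (h1 : k ≤ L)
    (h2 : ∀ i ∈ s, ∀ j, (σ ^ i) (a j) ∈ L) : zSeqField σ k a s ≤ L := by
  rw [zSeqField, Subfield.closure_le, Set.union_subset_iff]
  refine ⟨h1, ?_⟩
  rintro x ⟨j, i, hi, rfl⟩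
  exact h2 i hi j

theorem mem_zSeq {s : Set ℤ} {i : ℤ} (hi : i ∈ s) (j : ι) : (σ ^ i) (a j) ∈ zSeqField σ k a s :=
  Subfield.subset_closure (Or.inr ⟨j, i, hi, rfl⟩)

theorem le_zSeq (s : Set ℤ) : k ≤ zSeqField σ k a s :=
  fun _ hx => Subfield.subset_closure (Or.inl hx)

theorem zSeq_sup (s t : Set ℤ) :
    zSeqField σ k a s ⊔ zSeqField σ k a t = zSeqField σ k a (s ∪ t) := by
  apply le_antisymm
  · exact sup_le (zSeq_mono σ k a Set.subset_union_left) (zSeq_mono σ k a Set.subset_union_right)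
  · apply zSeq_le
    · exact (le_zSeq σ k a s).trans le_sup_left
    · rintro i (hi | hi) j
      · exact (le_sup_left : zSeqField σ k a s ≤ _) (mem_zSeq σ k a hi j)
      · exact (le_sup_right : zSeqField σ k a t ≤ _) (mem_zSeq σ k a hi j)

theorem seqField_eq_zSeq (n : ℕ) :
    seqField σ k a 1 n = zSeqField σ k a (Set.Icc 0 (n : ℤ)) := by
  unfold seqField zSeqField
  congr 2
  ext x
  constructor
  · rintro ⟨j, i, hi, rfl⟩
    exact ⟨j, i, ⟨by positivity, by exact_mod_cast hi⟩, by simp⟩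
  · rintro ⟨j, i, ⟨h0, hi⟩, rfl⟩
    lift i to ℕ using h0
    exact ⟨j, i, by exact_mod_cast hi, by simp⟩

theorem zSeq_map (hk : k.map (σ : Ω →+* Ω) = k) (p q : ℤ) :
    (zSeqField σ k a (Set.Icc p q)).map (σ : Ω →+* Ω) =
      zSeqField σ k a (Set.Icc (p + 1) (q + 1)) := by
  have hs : ∀ (i : ℤ) (j : ι), σ ((σ ^ i) (a j)) = (σ ^ (i + 1)) (a j) := by
    intro i j
    rw [add_comm, zpow_add, zpow_one]; rfl
  unfold zSeqField
  rw [RingHom.map_field_closure, Set.image_union]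
  congr 2
  · exact congrArg SetLike.coe hk
  · ext x
    constructor
    · rintro ⟨_, ⟨j, i, ⟨h0, hi⟩, rfl⟩, rfl⟩
      exact ⟨j, i + 1, ⟨by omega, by omega⟩, hs i j⟩
    · rintro ⟨j, i, ⟨h0, hi⟩, rfl⟩
      refine ⟨_, ⟨j, i - 1, ⟨by omega, by omega⟩, rfl⟩, ?_⟩
      have := hs (i - 1) j
      rw [sub_add_cancel] at this
      exact this

theorem zSeq_shift (hk : k.map (σ : Ω →+* Ω) = k) (n : ℕ) (p q p' q' : ℤ) :
    (zSeqField σ k a (Set.Icc p q)).relfinrank (zSeqField σ k a (Set.Icc p' q')) =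
    (zSeqField σ k a (Set.Icc (p + n) (q + n))).relfinrank
      (zSeqField σ k a (Set.Icc (p' + n) (q' + n))) := by
  induction n with
  | zero => simp
  | succ n ih =>
    rw [ih, ← Subfield.relfinrank_map_map _ _ (σ : Ω →+* Ω), zSeq_map σ k a hk,
      zSeq_map σ k a hk]
    push_cast
    simp only [add_assoc]

theorem zSeq_iUnion_finset (S : ℕ → Set ℤ) (hS : Monotone S) (t : Finset Ω)
    (ht : (t : Set Ω) ⊆ zSeqField σ k a (⋃ n, S n)) :
    ∃ n, (t : Set Ω) ⊆ zSeqField σ k a (S n) := by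
  have hm : Monotone (fun n => zSeqField σ k a (S n)) := fun m n h => zSeq_mono σ k a (hS h)
  have hle : zSeqField σ k a (⋃ n, S n) ≤ ⨆ n, zSeqField σ k a (S n) := by
    apply zSeq_le
    · exact (le_zSeq σ k a (S 0)).trans (le_iSup (fun n => zSeqField σ k a (S n)) 0)
    · intro i hi j
      obtain ⟨n, hn⟩ := Set.mem_iUnion.1 hi
      exact (le_iSup (fun n => zSeqField σ k a (S n)) n) (mem_zSeq σ k a hn j)
  have hex : ∀ x ∈ t, ∃ n, x ∈ zSeqField σ k a (S n) := fun x hx =>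
    (Subfield.mem_iSup_of_directed hm.directed_le).1 (hle (ht hx))
  choose! f hf using hex
  exact ⟨t.sup f, fun x hx => hm (Finset.le_sup (f := f) hx) (hf x hx)⟩

end

theorem limit_degree_attained_iff_linearDisjoint
    (Ω : Type*) [Field Ω] (σ : Ω ≃+* Ω) (k : Subfield Ω)
    (hk : k.map (σ : Ω →+* Ω) = k)
    (r : ℕ) (a : Fin r → Ω)
    (d : ℕ → ℕ) (hd : ∀ n : ℕ, d n = sdeg (seqField σ k a 1 n) (seqField σ k a 1 (n + 1)))
    (hfin : ∀ n : ℕ, 0 < d n)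
    (ld : ℕ) (hld : ∃ N : ℕ, ∀ n ≥ N, d n = ld)
    (E Fneg Fpos : Subfield Ω)
    (hE : E = zSeqField σ k a {0})
    (hFneg : Fneg = zSeqField σ k a {i : ℤ | i ≤ 0})
    (hFpos : Fpos = zSeqField σ k a {i : ℤ | 0 ≤ i}) :
    d 0 = ld ↔
      (IntermediateField.adjoin E (Fneg : Set Ω)).LinearDisjoint
        (IntermediateField.adjoin E (Fpos : Set Ω)) := by
  -- degrees in terms of intervals
  have hd1 : ∀ n : ℕ, d n = (zSeqField σ k a (Set.Icc 0 (n : ℤ))).relfinrank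
      (zSeqField σ k a (Set.Icc 0 ((n : ℤ) + 1))) := by
    intro n
    rw [hd, seqField_eq_zSeq, seqField_eq_zSeq, sdeg_eq_relfinrank]
    · push_cast; rfl
    · apply zSeq_mono
      apply Set.Icc_subset_Icc_right
      push_cast; omega
  have hE' : E = zSeqField σ k a (Set.Icc 0 0) := by rw [hE, Set.Icc_self]
  -- products of degrees
  have hG : ∀ n m : ℕ, (zSeqField σ k a (Set.Icc (-(n : ℤ)) 0)).relfinrank
      (zSeqField σ k a (Set.Icc (-(n : ℤ)) m)) = ∏ i ∈ Finset.range m, d (n + i) := by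
    intro n m
    induction m with
    | zero => simp
    | succ m ih =>
      rw [Finset.prod_range_succ, ← ih, hd1]
      rw [← Subfield.relfinrank_mul_relfinrank
        (B := zSeqField σ k a (Set.Icc (-(n : ℤ)) m))
        (zSeq_mono σ k a (Set.Icc_subset_Icc_right (by positivity)))
        (zSeq_mono σ k a (Set.Icc_subset_Icc_right (by push_cast; omega)))]
      congr 1
      rw [zSeq_shift σ k a hk n]
      congr 3 <;> push_cast <;> ring
  have hsup : ∀ n m : ℕ, zSeqField σ k a (Set.Icc (-(n : ℤ)) 0) ⊔
      zSeqField σ k a (Set.Icc 0 (m : ℤ)) = zSeqField σ k a (Set.Icc (-(n : ℤ)) m) := by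
    intro n m
    rw [zSeq_sup, Set.Icc_union_Icc_eq_Icc (by omega) (by omega)]
  have hG0 : ∀ m : ℕ, E.relfinrank (zSeqField σ k a (Set.Icc 0 (m : ℤ))) =
      ∏ i ∈ Finset.range m, d i := by
    intro m
    have := hG 0 m
    simpa [← hE] using this
  have hEn : ∀ n : ℕ, E ≤ zSeqField σ k a (Set.Icc (-(n : ℤ)) 0) := by
    intro n; rw [hE']; exact zSeq_mono σ k a (Set.Icc_subset_Icc_left (by omega))
  have hEp : ∀ m : ℕ, E ≤ zSeqField σ k a (Set.Icc 0 (m : ℤ)) := by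
    intro n; rw [hE']; exact zSeq_mono σ k a (Set.Icc_subset_Icc_right (by omega))
  have key := fun n m => ld_key (hEn n) (hEp m) (hsup n m)
    (by rw [hG0]; exact Finset.prod_pos fun i _ => hfin i)
  simp only [hG, hG0] at key
  -- monotonicity
  have hanti : Antitone d := by
    apply antitone_nat_of_succ_le
    intro n
    have h1 := (ld_key (E := zSeqField σ k a (Set.Icc (-(n : ℤ)) 0))
      (A := zSeqField σ k a (Set.Icc (-((n + 1 : ℕ) : ℤ)) 0))
      (B := zSeqField σ k a (Set.Icc (-(n : ℤ)) (1 : ℕ)))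
      (C := zSeqField σ k a (Set.Icc (-((n + 1 : ℕ) : ℤ)) (1 : ℕ)))
      (zSeq_mono σ k a (Set.Icc_subset_Icc_left (by push_cast; omega)))
      (zSeq_mono σ k a (Set.Icc_subset_Icc_right (by simp)))
      (by rw [zSeq_sup]; congr 1; ext x; simp only [Set.mem_union, Set.mem_Icc]; omega)
      (by rw [hG]; exact Finset.prod_pos fun i _ => hfin _)).1
    rw [hG, hG] at h1
    simpa using h1
  obtain ⟨N, hN⟩ := hld
  constructor
  · intro h0
    have hc : ∀ n, d n = d 0 := by
      intro n
      apply le_antisymm (hanti (Nat.zero_le n))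
      rw [h0, ← hN (max n N) (le_max_right _ _)]
      exact hanti (le_max_left _ _)
    have hLD : ∀ n m : ℕ, _ := fun n m => (key n m).2.2 (by simp only [hc])
    have hneg : {i : ℤ | i ≤ 0} = ⋃ n : ℕ, Set.Icc (-(n : ℤ)) 0 := by
      ext i
      simp only [Set.mem_ofPred_eq, Set.mem_iUnion, Set.mem_Icc]
      exact ⟨fun h => ⟨i.natAbs, by omega⟩, fun ⟨_, h⟩ => h.2⟩
    have hpos : {i : ℤ | 0 ≤ i} = ⋃ n : ℕ, Set.Icc 0 (n : ℤ) := by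
      ext i
      simp only [Set.mem_ofPred_eq, Set.mem_iUnion, Set.mem_Icc]
      exact ⟨fun h => ⟨i.natAbs, by omega⟩, fun ⟨_, h⟩ => h.1⟩
    have hEneg : E ≤ Fneg := by rw [hE, hFneg]; exact zSeq_mono σ k a (by simp)
    have hEpos : E ≤ Fpos := by rw [hE, hFpos]; exact zSeq_mono σ k a (by simp)
    rw [IntermediateField.linearDisjoint_iff', Subalgebra.linearDisjoint_iff]
    apply Submodule.LinearDisjoint.of_linearDisjoint_fg
    rintro _ _ hM hN ⟨s, rfl⟩ ⟨t, rfl⟩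
    rw [adjoin_eq_extendScalars hEneg, Submodule.span_le] at hM
    rw [adjoin_eq_extendScalars hEpos, Submodule.span_le] at hN
    obtain ⟨n, hn⟩ := zSeq_iUnion_finset σ k a (fun n : ℕ => Set.Icc (-(n : ℤ)) 0)
      (fun m n h => Set.Icc_subset_Icc_left (by omega)) s (by rw [← hneg, ← hFneg]; exact hM)
    obtain ⟨m, hm⟩ := zSeq_iUnion_finset σ k a (fun n : ℕ => Set.Icc 0 (n : ℤ))
      (fun m n h => Set.Icc_subset_Icc_right (by omega)) t (by rw [← hpos, ← hFpos]; exact hN)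
    have h := hLD n m
    rw [IntermediateField.linearDisjoint_iff', Subalgebra.linearDisjoint_iff] at h
    refine Submodule.LinearDisjoint.of_le_of_flat_left h ?_ ?_
    · rw [Submodule.span_le]
      exact fun x hx => IntermediateField.subset_adjoin E _ (hn hx)
    · rw [Submodule.span_le]
      exact fun x hx => IntermediateField.subset_adjoin E _ (hm hx)
  · intro H
    have h := (key N 1).2.1 (H.of_le
      (IntermediateField.adjoin.mono _ _ _ (by
        rw [hFneg]; exact zSeq_mono σ k a fun i hi => hi.2))
      (IntermediateField.adjoin.mono _ _ _ (by
        rw [hFpos]; exact zSeq_mono σ k a fun i hi => hi.1)))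
    simp only [Finset.prod_range_one, add_zero] at h
    rw [← h, hN N le_rfl]
end

section
/- Let k be a field, σ₀ a field automorphism of k, Ω a field extension of k, and τ a ring automorphism of Ω restricting to σ₀ on k. Let a = (a₁,…,a_n) be a tuple of elements of Ω, and for n' ≥ 0 set K_{n'} = k(τ^i(a_j) : 0 ≤ i ≤ n'); assume each degree [K_{n'+1} : K_{n'}] is finite. Let A = k[X_{j,i} : 1 ≤ j ≤ n, i ∈ ℤ] be the polynomial ring in variables indexed by Fin n × ℤ, Σ the ring automorphism of A acting as σ₀ on coefficients and sending X_{j,i} to X_{j,i+1}, Ev : A → Ω the ring homomorphism extending the inclusion k ⊆ Ω with Ev(X_{j,i}) = τ^i(a_j), and B the k-subalgebra of A generated by {X_{j,0}, X_{j,1} : j}. If the subfields k(τ^i(a) : i ≤ 0) and k(τ^i(a) : i ≥ 0) of Ω are linearly disjoint over k(a), then ker(Ev) is the unique prime ideal P̃ of A satisfying Σ(P̃) = P̃ and P̃ ∩ B = ker(Ev) ∩ B. -/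
set_option synthInstance.maxHeartbeats 1000000
set_option maxHeartbeats 2000000

open MvPolynomial

namespace KerEvalAux

lemma common_denom {k A Ω : Type*} [Field k] [CommRing A] [Algebra k A] [Field Ω] [Algebra k Ω]
    (Ev : A →ₐ[k] Ω) (D : Subalgebra k A) {ι : Type*} [Finite ι] (e : ι → Ω)
    (he : ∀ i, ∃ u ∈ D, ∃ v ∈ D, Ev v ≠ 0 ∧ e i * Ev v = Ev u) :
    ∃ v ∈ D, Ev v ≠ 0 ∧ ∃ u : ι → A, (∀ i, u i ∈ D) ∧ ∀ i, e i * Ev v = Ev (u i) := by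
  classical
  cases nonempty_fintype ι
  choose u hu v hv hv0 h using he
  refine ⟨∏ i, v i, prod_mem fun i _ => hv i, ?_,
    fun i => u i * ∏ j ∈ Finset.univ.erase i, v j,
    fun i => mul_mem (hu i) (prod_mem fun i _ => hv i), fun i => ?_⟩
  · rw [map_prod]
    exact Finset.prod_ne_zero_iff.2 fun i _ => hv0 i
  · rw [← Finset.mul_prod_erase Finset.univ v (Finset.mem_univ i), map_mul, map_mul, ← mul_assoc, h]

lemma mem_sup_sum {k A : Type*} [Field k] [CommRing A] [Algebra k A] (S C : Subalgebra k A)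
    {f : A} (hf : f ∈ S ⊔ C) :
    ∃ (N : ℕ) (g c : Fin N → A), (∀ i, g i ∈ S) ∧ (∀ i, c i ∈ C) ∧ f = ∑ i, g i * c i := by
  have hf' : f ∈ Subalgebra.toSubmodule S * Subalgebra.toSubmodule C := by
    rw [Subalgebra.mul_toSubmodule]; exact hf
  clear hf
  refine Submodule.mul_induction_on hf' ?_ ?_
  · intro m hm n hn
    exact ⟨1, fun _ => m, fun _ => n, fun _ => hm, fun _ => hn, by simp⟩
  · intro x y hx hy
    obtain ⟨N, g, c, hg, hc, rfl⟩ := hx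
    obtain ⟨N', g', c', hg', hc', rfl⟩ := hy
    refine ⟨N + N', Fin.append g g', Fin.append c c', ?_, ?_, ?_⟩
    · intro i
      refine Fin.addCases (fun i => ?_) (fun i => ?_) i
      · simpa using hg i
      · simpa using hg' i
    · intro i
      refine Fin.addCases (fun i => ?_) (fun i => ?_) i
      · simpa using hc i
      · simpa using hc' i
    · simp [Fin.sum_univ_add]

lemma step1 {k A Ω : Type*} [Field k] [CommRing A] [Algebra k A] [Field Ω] [Algebra k Ω]
    (Ev : A →ₐ[k] Ω) (P : Ideal A) [P.IsPrime] (S C D : Subalgebra k A) (hDS : D ≤ S) (hDC : D ≤ C)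
    (E : Subfield Ω) (hE : ∀ e ∈ E, ∃ u ∈ D, ∃ v ∈ D, Ev v ≠ 0 ∧ e * Ev v = Ev u)
    (hS : ∀ g ∈ S, Ev g = 0 ↔ g ∈ P) (hC : ∀ g ∈ C, Ev g = 0 → g ∈ P)
    (hlin : ∀ {κ : Type} [Fintype κ] (c : κ → A), (∀ i, c i ∈ C) →
      LinearIndependent E (fun i => Ev (c i)) → ∀ g : κ → A, (∀ i, g i ∈ S) →
      ∑ i, Ev (g i) * Ev (c i) = 0 → ∀ i, Ev (g i) = 0)
    (f : A) (hf : f ∈ S ⊔ C) (hf0 : Ev f = 0) : f ∈ P := by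
  obtain ⟨N, g, c, hg, hc, rfl⟩ := mem_sup_sum S C hf
  obtain ⟨κ, b, hb, hsp, hli⟩ := exists_linearIndependent' E (fun i => Ev (c i))
  have : Finite κ := Finite.of_injective b hb
  cases nonempty_fintype κ
  have h1 : ∀ s, ∃ l : κ → E, ∑ t, l t • Ev (c (b t)) = Ev (c s) := by
    intro s
    have : Ev (c s) ∈ Submodule.span E (Set.range ((fun i => Ev (c i)) ∘ b)) := by
      rw [hsp]; exact Submodule.subset_span ⟨s, rfl⟩
    exact (Submodule.mem_span_range_iff_exists_fun E).1 this
  choose l hl using h1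
  obtain ⟨v, hv, hv0, u, hu, huv⟩ := common_denom Ev D (fun p : Fin N × κ => (l p.1 p.2 : Ω))
    (fun p => hE _ (l p.1 p.2).2)
  have h2 : ∀ s, v * c s - ∑ t, u (s, t) * c (b t) ∈ P := by
    intro s
    apply hC
    · exact sub_mem (mul_mem (hDC hv) (hc s)) (sum_mem fun t _ => mul_mem (hDC (hu _)) (hc _))
    · rw [map_sub, map_mul, map_sum, ← hl s, Finset.mul_sum, sub_eq_zero]
      refine Finset.sum_congr rfl fun t _ => ?_
      rw [map_mul, ← huv (s, t), Subfield.smul_def, smul_eq_mul]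
      ring
  have h3 : v * ∑ s, g s * c s - ∑ t, (∑ s, g s * u (s, t)) * c (b t) ∈ P := by
    have : v * ∑ s, g s * c s - ∑ t, (∑ s, g s * u (s, t)) * c (b t)
        = ∑ s, g s * (v * c s - ∑ t, u (s, t) * c (b t)) := by
      simp only [mul_sub, Finset.sum_sub_distrib, Finset.mul_sum, Finset.sum_mul]
      rw [Finset.sum_comm (s := (Finset.univ : Finset κ))]
      congr 1
      · exact Finset.sum_congr rfl fun _ _ => by ring
      · exact Finset.sum_congr rfl fun _ _ => Finset.sum_congr rfl fun _ _ => by ring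
    rw [this]
    exact sum_mem fun s _ => P.mul_mem_left _ (h2 s)
  have h3' : Ev (v * ∑ s, g s * c s - ∑ t, (∑ s, g s * u (s, t)) * c (b t)) = 0 := by
    have e : ∀ s, Ev (v * c s - ∑ t, u (s, t) * c (b t)) = 0 := by
      intro s
      rw [map_sub, map_mul, map_sum, ← hl s, Finset.mul_sum, sub_eq_zero]
      refine Finset.sum_congr rfl fun t _ => ?_
      rw [map_mul, ← huv (s, t), Subfield.smul_def, smul_eq_mul]
      ring
    have : v * ∑ s, g s * c s - ∑ t, (∑ s, g s * u (s, t)) * c (b t)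
        = ∑ s, g s * (v * c s - ∑ t, u (s, t) * c (b t)) := by
      simp only [mul_sub, Finset.sum_sub_distrib, Finset.mul_sum, Finset.sum_mul]
      rw [Finset.sum_comm (s := (Finset.univ : Finset κ))]
      congr 1
      · exact Finset.sum_congr rfl fun _ _ => by ring
      · exact Finset.sum_congr rfl fun _ _ => Finset.sum_congr rfl fun _ _ => by ring
    rw [this, map_sum]
    exact Finset.sum_eq_zero fun s _ => by rw [map_mul, e, mul_zero]
  have hmem : ∀ t, ∑ s, g s * u (s, t) ∈ S := fun t =>
    sum_mem fun s _ => mul_mem (hg s) (hDS (hu _))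
  have h4 : ∀ t, Ev (∑ s, g s * u (s, t)) = 0 := by
    apply hlin (fun t => c (b t)) (fun t => hc _) hli _ hmem
    rw [map_sub, map_mul, hf0, mul_zero, zero_sub, neg_eq_zero, map_sum] at h3'
    simpa only [map_mul] using h3'
  have h5 : v * ∑ s, g s * c s ∈ P := by
    have h6 : ∑ t, (∑ s, g s * u (s, t)) * c (b t) ∈ P :=
      sum_mem fun t _ => P.mul_mem_right _ ((hS _ (hmem t)).1 (h4 t))
    simpa using add_mem h3 h6
  exact ((Ideal.IsPrime.mem_or_mem ‹_› h5).resolve_left fun h => hv0 ((hS v (hDS hv)).2 h))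

lemma step2 {k A Ω : Type*} [Field k] [CommRing A] [Algebra k A] [Field Ω] [Algebra k Ω]
    (Ev : A →ₐ[k] Ω) (P : Ideal A) (S T : Subalgebra k A) (hST : S ≤ T)
    (M : Subfield Ω) (hM : ∀ e ∈ M, ∃ u ∈ S, ∃ v ∈ S, Ev v ≠ 0 ∧ e * Ev v = Ev u)
    (hS : ∀ g ∈ S, g ∈ P → Ev g = 0) (hT : ∀ g ∈ T, Ev g = 0 → g ∈ P)
    (halg : ∀ f ∈ T, IsAlgebraic M (Ev f))
    (f : A) (hf : f ∈ T) (hf0 : f ∈ P) : Ev f = 0 := by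
  by_contra hne
  obtain ⟨p, hp0, hp⟩ := (halg f hf).exists_nonzero_coeff_and_aeval_eq_zero
    (mem_nonZeroDivisors_of_ne_zero hne)
  obtain ⟨v, hv, hv0, u, hu, huv⟩ := common_denom Ev S
    (fun i : Fin (p.natDegree + 1) => (p.coeff i : Ω)) (fun i => hM _ (p.coeff i).2)
  have h1 : Ev (∑ i, u i * f ^ (i : ℕ)) = 0 := by
    rw [Polynomial.aeval_eq_sum_range, Finset.sum_range] at hp
    rw [map_sum]
    calc _ = Ev v * ∑ i : Fin (p.natDegree + 1), p.coeff i • Ev f ^ (i : ℕ) := by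
          rw [Finset.mul_sum]
          refine Finset.sum_congr rfl fun i _ => ?_
          rw [map_mul, ← huv, Subfield.smul_def, smul_eq_mul, map_pow]
          ring
      _ = 0 := by rw [hp, mul_zero]
  have h2 : ∑ i, u i * f ^ (i : ℕ) ∈ P :=
    hT _ (sum_mem fun i _ => mul_mem (hST (hu i)) (pow_mem hf _)) h1
  have h3 : u 0 ∈ P := by
    rw [Fin.sum_univ_succ] at h2
    have : ∑ i : Fin p.natDegree, u i.succ * f ^ ((i.succ : Fin _) : ℕ) ∈ P :=
      sum_mem fun i _ => P.mul_mem_left _ (by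
        rw [Fin.val_succ, pow_succ]; exact P.mul_mem_left _ hf0)
    have := (Ideal.add_mem_iff_left P this).1 h2
    simpa using this
  have h4 := hS _ (hu 0) h3
  rw [← huv] at h4
  rcases mul_eq_zero.1 h4 with h | h
  · exact hp0 (by exact_mod_cast h)
  · exact hv0 h

lemma frac {k Ω : Type*} [Field k] [Field Ω] [Algebra k Ω] (τ : Ω ≃+* Ω) {n : ℕ} (a : Fin n → Ω)
    (Ev : MvPolynomial (Fin n × ℤ) k →ₐ[k] Ω)
    (hEv : ∀ (j : Fin n) (i : ℤ), Ev (X (j, i)) = (τ ^ i) (a j)) (I : Set ℤ) :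
    ∀ e ∈ zSeqField τ (algebraMap k Ω).fieldRange a I, ∃ u ∈ supported k {p : Fin n × ℤ | p.2 ∈ I},
      ∃ v ∈ supported k {p : Fin n × ℤ | p.2 ∈ I}, Ev v ≠ 0 ∧ e * Ev v = Ev u := by
  intro e he
  induction he using Subfield.closure_induction with
  | mem x hx =>
    rcases hx with ⟨c, rfl⟩ | ⟨j, i, hi, rfl⟩
    · exact ⟨algebraMap _ _ c, Subalgebra.algebraMap_mem _ _, 1, one_mem _, by simp, by simp⟩
    · exact ⟨X (j, i), X_mem_supported.2 hi, 1, one_mem _, by simp, by simp [hEv]⟩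
  | one => exact ⟨1, one_mem _, 1, one_mem _, by simp, by simp⟩
  | add x y _ _ hx hy =>
    obtain ⟨u, hu, v, hv, h0, h⟩ := hx
    obtain ⟨u', hu', v', hv', h0', h'⟩ := hy
    exact ⟨u * v' + u' * v, add_mem (mul_mem hu hv') (mul_mem hu' hv), v * v', mul_mem hv hv',
      by simp [h0, h0'], by simp only [map_add, map_mul, ← h, ← h']; ring⟩
  | neg x _ hx =>
    obtain ⟨u, hu, v, hv, h0, h⟩ := hx
    exact ⟨-u, neg_mem hu, v, hv, h0, by simp [← h]⟩
  | inv x _ hx =>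
    obtain ⟨u, hu, v, hv, h0, h⟩ := hx
    by_cases hx0 : x = 0
    · exact ⟨0, zero_mem _, 1, one_mem _, by simp, by simp [hx0]⟩
    · refine ⟨v, hv, u, hu, ?_, ?_⟩
      · rw [← h]; exact mul_ne_zero hx0 h0
      · rw [← h]; field_simp
  | mul x y _ _ hx hy =>
    obtain ⟨u, hu, v, hv, h0, h⟩ := hx
    obtain ⟨u', hu', v', hv', h0', h'⟩ := hy
    exact ⟨u * u', mul_mem hu hu', v * v', mul_mem hv hv',
      by simp [h0, h0'], by simp only [map_mul, ← h, ← h']; ring⟩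

lemma ev_mem {k Ω : Type*} [Field k] [Field Ω] [Algebra k Ω] (τ : Ω ≃+* Ω) {n : ℕ} (a : Fin n → Ω)
    (Ev : MvPolynomial (Fin n × ℤ) k →ₐ[k] Ω)
    (hEv : ∀ (j : Fin n) (i : ℤ), Ev (X (j, i)) = (τ ^ i) (a j)) (I : Set ℤ)
    (f : MvPolynomial (Fin n × ℤ) k) (hf : f ∈ supported k {p : Fin n × ℤ | p.2 ∈ I}) :
    Ev f ∈ zSeqField τ (algebraMap k Ω).fieldRange a I := by
  induction hf using Algebra.adjoin_induction with
  | mem x hx =>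
    obtain ⟨⟨j, i⟩, hi, rfl⟩ := hx
    exact Subfield.subset_closure (Or.inr ⟨j, i, hi, hEv j i⟩)
  | algebraMap r =>
    rw [AlgHom.commutes]
    exact Subfield.subset_closure (Or.inl ⟨r, rfl⟩)
  | add x y _ _ hx hy => rw [map_add]; exact add_mem hx hy
  | mul x y _ _ hx hy => rw [map_mul]; exact mul_mem hx hy

lemma shift_mem {k : Type*} [Field k] {n : ℕ}
    (F : MvPolynomial (Fin n × ℤ) k ≃+* MvPolynomial (Fin n × ℤ) k) (t : ℤ) (s : k → k)
    (hC : ∀ c : k, F (C c) = C (s c))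
    (hX : ∀ (j : Fin n) (i : ℤ), F (X (j, i)) = X (j, i + t)) (I J : Set ℤ)
    (h : ∀ i ∈ I, i + t ∈ J)
    (f : MvPolynomial (Fin n × ℤ) k) (hf : f ∈ supported k {p : Fin n × ℤ | p.2 ∈ I}) :
    F f ∈ supported k {p : Fin n × ℤ | p.2 ∈ J} := by
  induction hf using Algebra.adjoin_induction with
  | mem x hx =>
    obtain ⟨⟨j, i⟩, hi, rfl⟩ := hx
    rw [hX]
    exact X_mem_supported.2 (h i hi)
  | algebraMap r =>
    rw [MvPolynomial.algebraMap_eq, hC]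
    exact Subalgebra.algebraMap_mem _ _
  | add x y _ _ hx hy => rw [map_add]; exact add_mem hx hy
  | mul x y _ _ hx hy => rw [map_mul]; exact mul_mem hx hy

end KerEvalAux

open KerEvalAux

/-- Let `τ` be an automorphism of a field extension `Ω` of `k`
restricting to `σ₀` on `k`, let `a` be a tuple in `Ω` with all degrees
`[K_{n'+1} : K_{n'}]` finite, where `K_{n'} = k(τ^i(a_j) : 0 ≤ i ≤ n')`.  Let
`A = k[X_{j,i} : j, i ∈ ℤ]`, `Φ` the automorphism of `A` acting as `σ₀` on
coefficients with `Φ(X_{j,i}) = X_{j,i+1}`, `Ev : A → Ω` the evaluation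
`X_{j,i} ↦ τ^i(a_j)`, and `B` the `k`-subalgebra generated by the `X_{j,0}, X_{j,1}`.
If `k(τ^i(a) : i ≤ 0)` and `k(τ^i(a) : i ≥ 0)` are linearly disjoint over `k(a)`,
then `ker Ev` is the unique prime ideal `P̃` of `A` with `Φ(P̃) = P̃` and
`P̃ ∩ B = ker Ev ∩ B`. -/
theorem ker_eval_unique_invariant_prime_of_linearDisjoint
    (k : Type*) [Field k] (σ₀ : k ≃+* k)
    (Ω : Type*) [Field Ω] [Algebra k Ω] (τ : Ω ≃+* Ω)
    (hτ : ∀ c : k, τ (algebraMap k Ω c) = algebraMap k Ω (σ₀ c))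
    (n : ℕ) (a : Fin n → Ω)
    (k' : Subfield Ω) (hk' : k' = (algebraMap k Ω).fieldRange)
    (d : ℕ → ℕ)
    (hd : ∀ n' : ℕ, d n' = sdeg (seqField τ k' a 1 n') (seqField τ k' a 1 (n' + 1)))
    (hfin : ∀ n' : ℕ, 0 < d n')
    (Φ : MvPolynomial (Fin n × ℤ) k ≃+* MvPolynomial (Fin n × ℤ) k)
    (hΦC : ∀ c : k, Φ (C c) = C (σ₀ c))
    (hΦX : ∀ (j : Fin n) (i : ℤ), Φ (X (j, i)) = X (j, i + 1))
    (Ev : MvPolynomial (Fin n × ℤ) k →ₐ[k] Ω)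
    (hEv : ∀ (j : Fin n) (i : ℤ), Ev (X (j, i)) = (τ ^ i) (a j))
    (B : Subalgebra k (MvPolynomial (Fin n × ℤ) k))
    (hB : B = Algebra.adjoin k {x | ∃ j : Fin n, x = X (j, 0) ∨ x = X (j, 1)})
    (E Fneg Fpos : Subfield Ω)
    (hE : E = zSeqField τ k' a {0})
    (hFneg : Fneg = zSeqField τ k' a {i : ℤ | i ≤ 0})
    (hFpos : Fpos = zSeqField τ k' a {i : ℤ | 0 ≤ i})
    (hdisj : (IntermediateField.adjoin E (Fneg : Set Ω)).LinearDisjoint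
      (IntermediateField.adjoin E (Fpos : Set Ω))) :
    (RingHom.ker Ev.toRingHom).IsPrime ∧
    Ideal.map (Φ : MvPolynomial (Fin n × ℤ) k →+* MvPolynomial (Fin n × ℤ) k)
        (RingHom.ker Ev.toRingHom) = RingHom.ker Ev.toRingHom ∧
    (∀ P' : Ideal (MvPolynomial (Fin n × ℤ) k), P'.IsPrime →
      Ideal.map (Φ : MvPolynomial (Fin n × ℤ) k →+* MvPolynomial (Fin n × ℤ) k) P' = P' →
      Ideal.comap B.val P' = Ideal.comap B.val (RingHom.ker Ev.toRingHom) →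
      P' = RingHom.ker Ev.toRingHom) := by
  subst hk' hB
  have hEvΦ : ∀ f, Ev (Φ f) = τ (Ev f) := by
    intro f
    induction f using MvPolynomial.induction_on with
    | C c =>
      rw [hΦC, ← MvPolynomial.algebraMap_eq, AlgHom.commutes, AlgHom.commutes, hτ]
    | add p q hp hq => simp only [map_add, hp, hq]
    | mul_X p q hp =>
      obtain ⟨j, i⟩ := q
      rw [map_mul, map_mul, map_mul, map_mul, hp, hΦX, hEv, hEv, add_comm i 1, zpow_add, zpow_one]
      rfl
  have hker : ∀ f, f ∈ RingHom.ker Ev.toRingHom ↔ Ev f = 0 := fun f => Iff.rfl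
  have hmapiff : ∀ P : Ideal (MvPolynomial (Fin n × ℤ) k), Ideal.map
      (Φ : MvPolynomial (Fin n × ℤ) k →+* MvPolynomial (Fin n × ℤ) k) P = P ↔
      ∀ f, Φ f ∈ P ↔ f ∈ P := by
    intro P
    have hmap : ∀ f, f ∈ Ideal.map
      (Φ : MvPolynomial (Fin n × ℤ) k →+* MvPolynomial (Fin n × ℤ) k) P ↔ ∃ g ∈ P, Φ g = f := by
      intro f
      exact Ideal.mem_map_iff_of_surjective
        (Φ : MvPolynomial (Fin n × ℤ) k →+* MvPolynomial (Fin n × ℤ) k) Φ.surjective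
    constructor
    · intro h f
      conv_lhs => rw [← h]
      rw [hmap]
      constructor
      · rintro ⟨g, hg, h'⟩
        rwa [← Φ.injective h']
      · exact fun hf => ⟨f, hf, rfl⟩
    · intro h
      ext f
      rw [hmap]
      constructor
      · rintro ⟨g, hg, rfl⟩
        exact (h g).2 hg
      · intro hf
        exact ⟨Φ.symm f, (h _).1 (by simpa using hf), by simp⟩
  refine ⟨RingHom.ker_isPrime _, ?_, ?_⟩
  · rw [hmapiff]
    intro f
    rw [hker, hker, hEvΦ]
    simp
  intro P hP hPΦ hPB
  rw [hmapiff] at hPΦ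
  have hB : ∀ f ∈ supported k {p : Fin n × ℤ | p.2 ∈ ({0, 1} : Set ℤ)}, (Ev f = 0 ↔ f ∈ P) := by
    intro f hf
    have hf' : f ∈ Algebra.adjoin k {x : MvPolynomial (Fin n × ℤ) k |
        ∃ j : Fin n, x = X (j, 0) ∨ x = X (j, 1)} := by
      refine Algebra.adjoin_mono ?_ hf
      rintro _ ⟨⟨j, i⟩, hi, rfl⟩
      rcases hi with hi | hi
      · exact ⟨j, Or.inl (by rw [show i = 0 from hi])⟩
      · exact ⟨j, Or.inr (by rw [show i = 1 from hi])⟩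
    have := SetLike.ext_iff.1 hPB ⟨f, hf'⟩
    exact this.symm
  -- shifting
  have hup : ∀ I J : Set ℤ, (∀ i ∈ J, i + 1 ∈ I) →
      (∀ f ∈ supported k {p : Fin n × ℤ | p.2 ∈ I}, (Ev f = 0 ↔ f ∈ P)) →
      (∀ f ∈ supported k {p : Fin n × ℤ | p.2 ∈ J}, (Ev f = 0 ↔ f ∈ P)) := by
    intro I J h hI f hf
    have := hI (Φ f) (shift_mem Φ 1 σ₀ hΦC hΦX J I h f hf)
    rw [hPΦ, hEvΦ] at this
    simpa using this
  have hdown : ∀ I J : Set ℤ, (∀ i ∈ J, i + (-1) ∈ I) →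
      (∀ f ∈ supported k {p : Fin n × ℤ | p.2 ∈ I}, (Ev f = 0 ↔ f ∈ P)) →
      (∀ f ∈ supported k {p : Fin n × ℤ | p.2 ∈ J}, (Ev f = 0 ↔ f ∈ P)) := by
    intro I J h hI f hf
    have := hI (Φ.symm f) (shift_mem Φ.symm (-1) σ₀.symm
      (fun c => by rw [RingEquiv.symm_apply_eq, hΦC]; simp)
      (fun j i => by rw [RingEquiv.symm_apply_eq, hΦX]; simp) J I h f hf)
    rw [← hPΦ] at this
    have h2 := hEvΦ (Φ.symm f)
    rw [RingEquiv.apply_symm_apply] at h2 this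
    rw [← this, h2]
    simp
  -- algebraicity of `τ a_j`
  have hK0 : seqField τ (algebraMap k Ω).fieldRange a 1 0 = E := by
    rw [hE, seqField, zSeqField]
    congr 2
    ext x
    simp
  have halg1 : ∀ j, IsAlgebraic E (τ (a j)) := by
    have h0 := hfin 0
    rw [hd 0, sdeg, hK0] at h0
    have := Module.finite_of_finrank_pos h0
    intro j
    have hm : τ (a j) ∈ IntermediateField.adjoin E
        ((seqField τ (algebraMap k Ω).fieldRange a 1 (0 + 1) : Subfield Ω) : Set Ω) := by
      apply IntermediateField.subset_adjoin
      exact Subfield.subset_closure (Or.inr ⟨j, 1, le_rfl, by simp⟩)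
    have := Algebra.IsAlgebraic.isAlgebraic (R := E) (⟨_, hm⟩ : IntermediateField.adjoin E
        ((seqField τ (algebraMap k Ω).fieldRange a 1 (0 + 1) : Subfield Ω) : Set Ω))
    exact (IntermediateField.isAlgebraic_iff).1 this
  have hmain : ∀ m : ℕ, ∀ f ∈ supported k {p : Fin n × ℤ | p.2 ∈ Set.Icc (-(m : ℤ)) 0},
      (Ev f = 0 ↔ f ∈ P) := by
    intro m
    induction m with
    | zero =>
      intro f hf
      refine hB f (supported_mono ?_ hf)
      intro p hp
      left
      simpa using hp
    | succ m ih =>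
      refine hup (Set.Icc (-(m : ℤ)) 1) _ (fun i hi => ?_) ?_
      · simp only [Set.mem_Icc] at hi ⊢
        push_cast at hi
        omega
      have hsup : supported k {p : Fin n × ℤ | p.2 ∈ Set.Icc (-(m : ℤ)) 1} =
          supported k {p : Fin n × ℤ | p.2 ∈ Set.Icc (-(m : ℤ)) 0} ⊔
          supported k {p : Fin n × ℤ | p.2 ∈ ({0, 1} : Set ℤ)} := by
        rw [supported_eq_adjoin_X, supported_eq_adjoin_X, supported_eq_adjoin_X,
          ← Algebra.adjoin_union, ← Set.image_union]
        congr 2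
        ext p
        simp only [Set.mem_Icc, Set.mem_ofPred_eq, Set.mem_union, Set.mem_insert_iff,
          Set.mem_singleton_iff]
        omega
      have h1 : ∀ f ∈ supported k {p : Fin n × ℤ | p.2 ∈ Set.Icc (-(m : ℤ)) 1},
          Ev f = 0 → f ∈ P := by
        intro f hf
        rw [hsup] at hf
        refine step1 Ev P (supported k {p : Fin n × ℤ | p.2 ∈ Set.Icc (-(m : ℤ)) 0})
          (supported k {p : Fin n × ℤ | p.2 ∈ ({0, 1} : Set ℤ)})
          (supported k {p : Fin n × ℤ | p.2 ∈ ({0} : Set ℤ)}) (supported_mono ?_)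
          (supported_mono ?_) E ?_ ih (fun g hg => (hB g hg).1) ?_ f hf
        · intro p hp
          have : p.2 = 0 := hp
          simp [this]
        · intro p hp
          exact Or.inl hp
        · rw [hE]
          exact frac τ a Ev hEv _
        · intro κ _ c hc hli g hg h0
          have hcF : ∀ i, Ev (c i) ∈ IntermediateField.adjoin E (Fpos : Set Ω) := by
            intro i
            apply IntermediateField.subset_adjoin
            rw [hFpos]
            refine ev_mem τ a Ev hEv _ _ (supported_mono ?_ (hc i))
            rintro p (hp | hp)
            · exact (show p.2 = 0 from hp).ge
            · exact le_of_le_of_eq zero_le_one (show p.2 = 1 from hp).symm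
          have hgF : ∀ i, Ev (g i) ∈ IntermediateField.adjoin E (Fneg : Set Ω) := by
            intro i
            apply IntermediateField.subset_adjoin
            rw [hFneg]
            refine ev_mem τ a Ev hEv _ _ (supported_mono ?_ (hg i))
            intro p hp
            exact hp.2
          have hli' : LinearIndependent E
              (fun i => (⟨Ev (c i), hcF i⟩ : IntermediateField.adjoin E (Fpos : Set Ω))) := by
            apply LinearIndependent.of_comp
              (IntermediateField.adjoin E (Fpos : Set Ω)).val.toLinearMap
            exact hli
          have h2 := hdisj.linearIndependent_right hli'
          rw [Fintype.linearIndependent_iff] at h2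
          have h3 := h2 (fun i => ⟨Ev (g i), hgF i⟩) h0
          intro i
          exact congrArg Subtype.val (h3 i)
      intro f hf
      refine ⟨h1 f hf, ?_⟩
      refine step2 Ev P (supported k {p : Fin n × ℤ | p.2 ∈ Set.Icc (-(m : ℤ)) 0})
        (supported k {p : Fin n × ℤ | p.2 ∈ Set.Icc (-(m : ℤ)) 1}) ?_
        (zSeqField τ (algebraMap k Ω).fieldRange a (Set.Icc (-(m : ℤ)) 0))
        (frac τ a Ev hEv _) (fun g hg => (ih g hg).2) h1 ?_ f hf
      · rw [hsup]; exact le_sup_left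
      · have hEM : E ≤ zSeqField τ (algebraMap k Ω).fieldRange a (Set.Icc (-(m : ℤ)) 0) := by
          rw [hE]
          apply Subfield.closure_mono
          apply Set.union_subset_union_right
          rintro x ⟨j, i, hi, rfl⟩
          refine ⟨j, i, ?_, rfl⟩
          rw [show i = 0 from hi]
          simp
        generalize hMdef : zSeqField τ (algebraMap k Ω).fieldRange a (Set.Icc (-(m : ℤ)) 0) = M
          at hEM
        let : Algebra E M := (Subfield.inclusion hEM).toAlgebra
        have : IsScalarTower E M Ω := IsScalarTower.of_algebraMap_eq fun x => rfl
        intro f hf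
        have hMalg : ∀ x ∈ M, IsAlgebraic M x := fun x hx => isAlgebraic_algebraMap (⟨x, hx⟩ : M)
        induction hf using Algebra.adjoin_induction with
        | mem x hx =>
          obtain ⟨⟨j, i⟩, hi, rfl⟩ := hx
          rw [hEv]
          by_cases hi1 : i = 1
          · subst hi1
            rw [zpow_one]
            exact (halg1 j).tower_top M
          · apply hMalg
            rw [← hMdef]
            refine Subfield.subset_closure (Or.inr ⟨j, i, ?_, rfl⟩)
            simp only [Set.mem_Icc, Set.mem_ofPred_eq] at hi ⊢
            omega
        | algebraMap r =>
          rw [AlgHom.commutes]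
          apply hMalg
          rw [← hMdef]
          exact Subfield.subset_closure (Or.inl ⟨r, rfl⟩)
        | add x y _ _ hx hy => rw [map_add]; exact hx.add hy
        | mul x y _ _ hx hy => rw [map_mul]; exact hx.mul hy
  have hall : ∀ (m t : ℕ), ∀ f ∈ supported k {p : Fin n × ℤ | p.2 ∈ Set.Icc (-(m : ℤ)) t},
      (Ev f = 0 ↔ f ∈ P) := by
    intro m t
    induction t generalizing m with
    | zero => simpa using hmain m
    | succ t ih =>
      refine hdown (Set.Icc (-((m + 1 : ℕ) : ℤ)) t) _ (fun i hi => ?_) (ih (m + 1))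
      simp only [Set.mem_Icc] at hi ⊢
      push_cast at hi ⊢
      omega
  ext f
  rw [hker]
  symm
  set N : ℕ := f.vars.sup (fun p => p.2.natAbs) with hN
  refine hall N N f ?_
  rw [mem_supported]
  intro p hp
  have : p.2.natAbs ≤ N := Finset.le_sup (f := fun p : Fin n × ℤ => p.2.natAbs) hp
  simp only [Set.mem_Icc, Set.mem_ofPred_eq]
  omega
end
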